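/- (Frobenius property) Let p : X → Y be a Kan fibration of simplicial sets. Then pullback along p preserves anodyne maps: for every anodyne map i : A → B of simplicial sets over Y, the induced map X ×_Y A → X ×_Y B is anodyne. -/

import Mathlib

open CategoryTheory CategoryTheory.Limits Simplicial MonoidalCategory SSet

noncomputable instance : MonoidalClosed SSet.{0} :=
  (inferInstance : MonoidalClosed (SimplexCategoryᵒᵖ ⥤ Type 0))

namespace Paper

/-- A map of simplicial sets is a *trivial fibration* if it has the right lifting
property with respect to all boundary inclusions `∂Δ[n] ⟶ Δ[n]` for `n ≥ 0`. -/
def TrivialFibration {X Y : SSet.{0}} (p : X ⟶ Y) : Prop :=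
  ∀ n : ℕ, HasLiftingProperty (SSet.boundary.{0} n).ι p

/-- A map of simplicial sets is a *Kan fibration* if it has the right lifting property
with respect to all horn inclusions `Λ[n, i] ⟶ Δ[n]` for `n ≥ 1`, `0 ≤ i ≤ n`. -/
def KanFibration {X Y : SSet.{0}} (p : X ⟶ Y) : Prop :=
  ∀ (n : ℕ) (i : Fin (n + 2)), HasLiftingProperty (SSet.horn.{0} (n + 1) i).ι p

/-- An *anodyne* map is one with the left lifting property with respect to
all Kan fibrations. -/
def Anodyne {A B : SSet.{0}} (i : A ⟶ B) : Prop :=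
  ∀ ⦃X Y : SSet.{0}⦄ (p : X ⟶ Y), KanFibration p → HasLiftingProperty i p

/-- The unique map to `Δ[0]`. -/
def toPt (X : SSet.{0}) : X ⟶ Δ[0] where
  app m := ↾fun _ => SSet.stdSimplex.const 0 0 m
  naturality := by
    intro m m' φ
    ext x
    apply stdSimplex.objEquiv.injective
    apply SimplexCategory.Hom.ext
    apply OrderHom.ext
    funext j
    exact @Subsingleton.elim (Fin 1) _ _ _

/-- A *Kan complex* is a simplicial set whose map to `Δ[0]` is a Kan fibration. -/
def KanComplex (X : SSet.{0}) : Prop :=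
  KanFibration (toPt X)

/-- The constant map at the vertex `k` of `Δ[1]`. -/
def cst (X : SSet.{0}) (k : Fin 2) : X ⟶ Δ[1] where
  app m := ↾fun _ => SSet.stdSimplex.const 1 k m
  naturality := by
    intro m m' φ
    ext x
    apply stdSimplex.objEquiv.injective
    apply SimplexCategory.Hom.ext
    ext j
    rfl

/-- The endpoint inclusion `X ⟶ X ⊗ Δ[1]` at the vertex `k` of `Δ[1]`. -/
noncomputable def ept (X : SSet.{0}) (k : Fin 2) : X ⟶ X ⊗ Δ[1] :=
  CartesianMonoidalCategory.lift (𝟙 X) (cst X k)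

/-- A (single-step) homotopy from `f` to `g`, as a property of the pair `(f, g)`. -/
def Homotopy {X Y : SSet.{0}} (f g : X ⟶ Y) : Prop :=
  ∃ H : X ⊗ Δ[1] ⟶ Y, ept X 0 ≫ H = f ∧ ept X 1 ≫ H = g

/-- `f` and `g` are *homotopic* if they are connected by a zig-zag of homotopies. -/
def Homotopic {X Y : SSet.{0}} (f g : X ⟶ Y) : Prop :=
  Relation.EqvGen Homotopy f g

/-- A *homotopy equivalence* of simplicial sets. -/
def HomotopyEquivalence {X Y : SSet.{0}} (f : X ⟶ Y) : Prop :=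
  ∃ g : Y ⟶ X, Homotopic (f ≫ g) (𝟙 X) ∧ Homotopic (g ≫ f) (𝟙 Y)

/-- A map `f : X ⟶ Y` is a *weak homotopy equivalence* if for every Kan complex `K`
the induced map `K^Y ⟶ K^X` on exponentials is a homotopy equivalence. -/
def WeakHomotopyEquivalence {X Y : SSet.{0}} (f : X ⟶ Y) : Prop :=
  ∀ K : SSet.{0}, KanComplex K → HomotopyEquivalence ((MonoidalClosed.pre f).app K)

/-- A homotopy `H` between maps over `B` which is *fiberwise over `B`*. -/
def FibHomotopy {B X Y : SSet.{0}} (pX : X ⟶ B) (pY : Y ⟶ B) (f g : X ⟶ Y) : Prop :=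
  ∃ H : X ⊗ Δ[1] ⟶ Y, ept X 0 ≫ H = f ∧ ept X 1 ≫ H = g ∧
    H ≫ pY = SemiCartesianMonoidalCategory.fst X Δ[1] ≫ pX

/-- Connectedness by a zig-zag of fiberwise homotopies over `B`. -/
def FibHomotopic {B X Y : SSet.{0}} (pX : X ⟶ B) (pY : Y ⟶ B) (f g : X ⟶ Y) : Prop :=
  Relation.EqvGen (FibHomotopy pX pY) f g

/-- A *fiberwise homotopy equivalence over `B`*. -/
def FibHomotopyEquivalence {B X Y : SSet.{0}} (pX : X ⟶ B) (pY : Y ⟶ B) (f : X ⟶ Y) : Prop :=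
  f ≫ pY = pX ∧ ∃ g : Y ⟶ X, g ≫ pX = pY ∧
    FibHomotopic pX pX (f ≫ g) (𝟙 X) ∧ FibHomotopic pY pY (g ≫ f) (𝟙 Y)

end Paper



namespace Paper

lemma kanFibration_iff {X Y : SSet.{0}} (p : X ⟶ Y) :
    KanFibration p ↔ modelCategoryQuillen.J.rlp p := by
  refine ⟨fun h _ _ _ hi ↦ ?_, fun h n i ↦ h _ (modelCategoryQuillen.horn_ι_mem_J _ _)⟩
  simp only [modelCategoryQuillen.J, MorphismProperty.iSup_iff] at hi
  obtain ⟨n, ⟨i⟩⟩ := hi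
  exact h n i

lemma anodyne_iff {A B : SSet.{0}} (i : A ⟶ B) : Anodyne i ↔ anodyneExtensions i := by
  simp only [Anodyne, kanFibration_iff]
  rfl

lemma KanFibration.of_isPullback {E X B Y : SSet.{0}} {t : E ⟶ X} {p' : E ⟶ B} {p : X ⟶ Y}
    {b : B ⟶ Y} (sq : IsPullback t p' p b) (hp : KanFibration p) : KanFibration p' :=
  fun n i ↦ by
    have := hp n i
    exact sq.hasLiftingProperty _

lemma stdSimplex_ext {n : ℕ} {m : SimplexCategoryᵒᵖ} {x y : (Δ[n] : SSet.{0}).obj m}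
    (h : ∀ j, stdSimplex.asOrderHom x j = stdSimplex.asOrderHom y j) : x = y := by
  apply stdSimplex.objEquiv.injective
  apply SimplexCategory.Hom.ext
  apply OrderHom.ext
  funext j
  exact h j

lemma ept_naturality_assoc {X Y Z : SSet.{0}} (f : X ⟶ Y) (k : Fin 2) (h : Y ⊗ Δ[1] ⟶ Z) :
    ept X k ≫ f ▷ Δ[1] ≫ h = f ≫ ept Y k ≫ h := rfl

lemma horn_one_ι_eq_cst (k : Fin 2) : Λ[1, k].ι = cst (Λ[1, k] : SSet.{0}) k := by
  ext m ⟨x, hx⟩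
  apply stdSimplex_ext
  intro j
  rw [mem_horn_iff, Ne, Set.eq_univ_iff_forall] at hx
  push Not at hx
  obtain ⟨y, hy⟩ := hx
  simp only [Set.mem_union, Set.mem_range, Set.mem_singleton_iff, not_or, not_exists] at hy
  have := hy.1 j
  change stdSimplex.asOrderHom x j = k
  grind

lemma whiskerLeft_horn_one_ι (X : SSet.{0}) (k : Fin 2) :
    X ◁ Λ[1, k].ι = SemiCartesianMonoidalCategory.fst X _ ≫ ept X k := by
  rw [horn_one_ι_eq_cst]
  rfl

lemma anodyne_ept (X : SSet.{0}) (k : Fin 2) : Anodyne (ept X k) := by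
  intro Z W q hq
  have := (anodyne_iff _).2 ((anodyneExtensions.horn_ι k).whiskerLeft X) q hq
  have hr : Subcomplex.range (cst X k) ≤ Λ[1, k] := by
    rintro m _ ⟨x, rfl⟩
    rw [mem_horn_iff, Ne, Set.eq_univ_iff_forall]
    push Not
    refine ⟨k.rev, ?_⟩
    simp only [Set.mem_union, Set.mem_range, Set.mem_singleton_iff, not_or, not_exists]
    refine ⟨fun j ↦ ?_, ?_⟩
    · change k ≠ k.rev
      fin_cases k <;> decide
    · fin_cases k <;> decide
  let s : X ⟶ X ⊗ (Λ[1, k] : SSet.{0}) :=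
    CartesianMonoidalCategory.lift (𝟙 X) (Subcomplex.lift (cst X k) hr)
  have hs : s ≫ X ◁ Λ[1, k].ι = ept X k := rfl
  have hs' : s ≫ SemiCartesianMonoidalCategory.fst X _ = 𝟙 X := rfl
  constructor
  intro u v w
  have sq : CommSq (SemiCartesianMonoidalCategory.fst X _ ≫ u) (X ◁ Λ[1, k].ι) q v := ⟨by
    rw [whiskerLeft_horn_one_ι, Category.assoc, Category.assoc, w.w]⟩
  refine ⟨⟨⟨sq.lift, ?_, sq.fac_right⟩⟩⟩
  rw [← hs, Category.assoc, sq.fac_left, reassoc_of% hs']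

/-- A map `j : A ⟶ B` is a *directed deformation* if there is a homotopy of endomorphisms of `B`
which preserves `A`, takes values in `A` at the vertex `k` and is the identity at the vertex `l`.
The homotopy is not required to be constant on `A`. -/
def DirectedDeformation {A B : SSet.{0}} (j : A ⟶ B) (k l : Fin 2) : Prop :=
  ∃ (g : B ⟶ A) (φ : A ⊗ Δ[1] ⟶ A) (ψ : B ⊗ Δ[1] ⟶ B),
    ept B k ≫ ψ = g ≫ j ∧ ept B l ≫ ψ = 𝟙 B ∧ j ▷ Δ[1] ≫ ψ = φ ≫ j

lemma DirectedDeformation.anodyne {A B : SSet.{0}} {j : A ⟶ B} [Mono j] {k l : Fin 2}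
    (h : DirectedDeformation j k l) : Anodyne j := by
  intro Z W q hq
  obtain ⟨g, φ, ψ, hk, hl, hj⟩ := h
  let sq := Functor.PushoutObjObj.ofHasPushout (curriedTensor SSet.{0}) j Λ[1, k].ι
  have hsq : Anodyne sq.ι :=
    (anodyne_iff _).2 (anodyneExtensions_pushoutObjObjι sq (.horn_ι k))
  have := hsq q hq
  have hφl : ept A l ≫ φ = 𝟙 A := by
    rw [← cancel_mono j, Category.assoc, ← hj, ept_naturality_assoc, hl]; simp
  have hφk : ept A k ≫ φ = j ≫ g := by
    rw [← cancel_mono j, Category.assoc, ← hj, ept_naturality_assoc, hk]; simp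
  constructor
  intro u v w
  let top : sq.pt ⟶ Z := sq.isPushout.desc (SemiCartesianMonoidalCategory.fst B _ ≫ g ≫ u)
    (φ ≫ u) (by
      change j ▷ _ ≫ _ = A ◁ _ ≫ _
      rw [whiskerLeft_horn_one_ι, Category.assoc, reassoc_of% hφk]
      rfl)
  have sq' : CommSq top sq.ι q (ψ ≫ v) := ⟨by
    apply sq.hom_ext
    · rw [sq.inl_ι_assoc, ← Category.assoc, sq.isPushout.inl_desc]
      change _ = B ◁ _ ≫ _
      rw [whiskerLeft_horn_one_ι]
      simp only [Category.assoc, reassoc_of% hk, w.w]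
    · rw [sq.inr_ι_assoc, ← Category.assoc, sq.isPushout.inr_desc]
      change _ = j ▷ _ ≫ _
      simp only [Category.assoc, reassoc_of% hj, w.w]⟩
  refine ⟨⟨⟨ept B l ≫ sq'.lift, ?_, ?_⟩⟩⟩
  · have h1 : j ▷ Δ[1] ≫ sq'.lift = φ ≫ u := by
      have := sq.inr_ι_assoc sq'.lift
      rw [sq'.fac_left, sq.isPushout.inr_desc] at this
      exact this.symm
    rw [← ept_naturality_assoc, h1, reassoc_of% hφl]
  · rw [Category.assoc, sq'.fac_right, reassoc_of% hl]

lemma DirectedDeformation.of_isPullback {A B E' E : SSet.{0}} {j : A ⟶ B} {j' : E' ⟶ E}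
    {p' : E' ⟶ A} {p : E ⟶ B} {k l : Fin 2} (h : DirectedDeformation j k l)
    (sq : IsPullback j' p' p j) (hp : KanFibration p) : DirectedDeformation j' k l := by
  obtain ⟨g, φ, ψ, hk, hl, hj⟩ := h
  have := anodyne_ept E l p hp
  have sq' : CommSq (𝟙 E) (ept E l) p (p ▷ Δ[1] ≫ ψ) := ⟨by
    rw [ept_naturality_assoc, hl, Category.id_comp, Category.comp_id]⟩
  refine ⟨sq.lift (ept E k ≫ sq'.lift) (p ≫ g) ?_,
    sq.lift (j' ▷ Δ[1] ≫ sq'.lift) (p' ▷ Δ[1] ≫ φ) ?_, sq'.lift, ?_, sq'.fac_left, ?_⟩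
  · rw [Category.assoc, sq'.fac_right, ept_naturality_assoc, hk, Category.assoc]
  · rw [Category.assoc, sq'.fac_right, Category.assoc, ← hj, ← comp_whiskerRight_assoc, sq.w,
      comp_whiskerRight_assoc]
  · rw [sq.lift_fst]
  · rw [sq.lift_fst]

/-- The map `Δ[n] ⊗ Δ[1] ⟶ Δ[n]` induced by a map of partially ordered sets. -/
noncomputable def homotopyMk {n : ℕ} (h : Fin (n + 1) × Fin 2 →o Fin (n + 1)) :
    Δ[n] ⊗ Δ[1] ⟶ (Δ[n] : SSet.{0}) where
  app m := ↾fun x ↦ stdSimplex.objMk (h.comp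
    ((stdSimplex.asOrderHom x.1).prod (stdSimplex.asOrderHom x.2)))

lemma directedDeformation_horn_of_orderHom {n : ℕ} (i : Fin (n + 1)) (k l : Fin 2)
    (h : Fin (n + 1) × Fin 2 →o Fin (n + 1)) (hl : ∀ x, h (x, l) = x)
    (hk : ∃ y, y ≠ i ∧ ∀ x, h (x, k) ≠ y)
    (hi : ∀ x t, h (x, t) = x ∨ h (x, t) = i) :
    DirectedDeformation (Λ[n, i] : (Δ[n] : SSet.{0}).Subcomplex).ι k l := by
  refine ⟨Subcomplex.lift (ept _ k ≫ homotopyMk h) ?_,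
    Subcomplex.lift (Λ[n, i].ι ▷ Δ[1] ≫ homotopyMk h) ?_, homotopyMk h, rfl, ?_, rfl⟩
  · obtain ⟨y, hyi, hy⟩ := hk
    rintro m _ ⟨x, rfl⟩
    rw [mem_horn_iff, Ne, Set.eq_univ_iff_forall]
    push Not
    refine ⟨y, ?_⟩
    simp only [Set.mem_union, Set.mem_range, Set.mem_singleton_iff, not_or, not_exists]
    exact ⟨fun j ↦ hy (stdSimplex.asOrderHom x j), hyi⟩
  · rintro m _ ⟨⟨⟨x, hx⟩, t⟩, rfl⟩
    rw [mem_horn_iff, Ne, Set.eq_univ_iff_forall] at hx ⊢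
    push Not at hx ⊢
    obtain ⟨y, hy⟩ := hx
    refine ⟨y, ?_⟩
    simp only [Set.mem_union, Set.mem_range, Set.mem_singleton_iff, not_or, not_exists] at hy ⊢
    refine ⟨fun j ↦ ?_, hy.2⟩
    change h (stdSimplex.asOrderHom x j, stdSimplex.asOrderHom t j) ≠ y
    have := hy.1 j
    grind
  · ext m x
    apply stdSimplex_ext
    intro j
    exact hl (stdSimplex.asOrderHom x j)

lemma exists_directedDeformation_horn (n : ℕ) (i : Fin (n + 2)) :
    ∃ k l, DirectedDeformation (Λ[n + 1, i] : (Δ[n + 1] : SSet.{0}).Subcomplex).ι k l := by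
  by_cases hi : i = Fin.last (n + 1)
  · let r : Fin (n + 2) × Fin 2 → Fin (n + 2) := fun x ↦ if x.2 = 0 then x.1 else max x.1 i
    have hr : Monotone r := by
      rintro ⟨x, t⟩ ⟨x', t'⟩ ⟨h, h'⟩
      dsimp [r] at h h' ⊢
      split_ifs <;> grind
    refine ⟨1, 0, directedDeformation_horn_of_orderHom i 1 0 ⟨r, hr⟩ (fun x ↦ ?_)
      ⟨0, ?_, fun x ↦ ?_⟩ fun x t ↦ ?_⟩
    · change r (x, 0) = x
      simp [r]
    · grind
    · change r (x, 1) ≠ 0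
      grind
    · change r (x, t) = x ∨ r (x, t) = i
      grind
  · let r : Fin (n + 2) × Fin 2 → Fin (n + 2) := fun x ↦ if x.2 = 0 then min x.1 i else x.1
    have hr : Monotone r := by
      rintro ⟨x, t⟩ ⟨x', t'⟩ ⟨h, h'⟩
      dsimp [r] at h h' ⊢
      split_ifs <;> grind
    refine ⟨0, 1, directedDeformation_horn_of_orderHom i 0 1 ⟨r, hr⟩ (fun x ↦ ?_)
      ⟨Fin.last _, ?_, fun x ↦ ?_⟩ fun x t ↦ ?_⟩
    · change r (x, 1) = x
      simp [r]
    · grind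
    · change r (x, 0) ≠ Fin.last _
      grind
    · change r (x, t) = x ∨ r (x, t) = i
      grind

lemma anodyne_of_isPullback_horn {n : ℕ} {i : Fin (n + 2)} {E' E : SSet.{0}} {j' : E' ⟶ E}
    {p' : E' ⟶ Λ[n + 1, i]} {p : E ⟶ Δ[n + 1]} (sq : IsPullback j' p' p Λ[n + 1, i].ι)
    (hp : KanFibration p) : Anodyne j' := by
  obtain ⟨k, l, h⟩ := exists_directedDeformation_horn n i
  have : Mono j' :=
    (MorphismProperty.monomorphisms SSet.{0}).of_isPullback sq.flip
      (MorphismProperty.monomorphisms.infer_property _)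
  exact (h.of_isPullback sq hp).anodyne

section DependentProduct

variable {E B Z W : SSet.{0}} (p : E ⟶ B) (q : Z ⟶ W) (u : E ⟶ W)

/-- An `n`-simplex of `pushforward p q u`: a simplex `base` of `B` together with a natural
lift through `q` of the restriction of `u` to the fiber of `p` over `base`. -/
structure PushforwardSimplex (n : SimplexCategoryᵒᵖ) where
  base : B.obj n
  sec ⦃m : SimplexCategoryᵒᵖ⦄ (θ : n ⟶ m) (x : E.obj m) (h : p.app m x = B.map θ base) : Z.obj m
  app_sec ⦃m : SimplexCategoryᵒᵖ⦄ (θ : n ⟶ m) (x : E.obj m) (h : p.app m x = B.map θ base) :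
    q.app m (sec θ x h) = u.app m x
  map_sec ⦃m m' : SimplexCategoryᵒᵖ⦄ (θ : n ⟶ m) (η : m ⟶ m') (x : E.obj m)
    (h : p.app m x = B.map θ base) (h' : p.app m' (E.map η x) = B.map (θ ≫ η) base) :
    Z.map η (sec θ x h) = sec (θ ≫ η) (E.map η x) h'

variable {p q u}

lemma PushforwardSimplex.ext' {n : SimplexCategoryᵒᵖ} {s t : PushforwardSimplex p q u n}
    (hb : s.base = t.base) (hs : ∀ ⦃m : SimplexCategoryᵒᵖ⦄ (θ : n ⟶ m) (x : E.obj m) h h',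
      s.sec θ x h = t.sec θ x h') : s = t := by
  obtain ⟨b, s, _, _⟩ := s
  obtain ⟨b', t, _, _⟩ := t
  obtain rfl : b = b' := hb
  obtain rfl : s = t := by
    ext m θ x h
    exact hs θ x h h
  rfl

lemma PushforwardSimplex.sec_congr {n : SimplexCategoryᵒᵖ} {s t : PushforwardSimplex p q u n}
    (hst : s = t) {m : SimplexCategoryᵒᵖ} {θ θ' : n ⟶ m} (hθ : θ = θ') {x x' : E.obj m}
    (hx : x = x') (h : p.app m x = B.map θ s.base) (h' : p.app m x' = B.map θ' t.base) :
    s.sec θ x h = t.sec θ' x' h' := by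
  subst hst hθ hx
  rfl

variable (p q u) in
/-- The simplicial set over `B` of local lifts of `u` through `q` along the fibers of `p`,
that is, the dependent product along `p` of the pullback of `q` along `u`. -/
def pushforward : SSet.{0} where
  obj n := PushforwardSimplex p q u n
  map {n n'} α := ↾fun s ↦
    { base := B.map α s.base
      sec m θ x h := s.sec (α ≫ θ) x (by simpa using h)
      app_sec m θ x h := s.app_sec _ _ _
      map_sec m m' θ η x h h' := by
        rw [s.map_sec (α ≫ θ) η x (by simpa using h) (by simpa using h')]
        exact PushforwardSimplex.sec_congr rfl (Category.assoc α θ η) rfl _ _ }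
  map_id n := by
    ext s
    exact PushforwardSimplex.ext' (by simp)
      fun m θ x h h' ↦ PushforwardSimplex.sec_congr rfl (Category.id_comp θ) rfl _ _
  map_comp α β := by
    ext s
    refine PushforwardSimplex.ext' ?_ fun m θ x h h' ↦
      PushforwardSimplex.sec_congr rfl (Category.assoc α β θ) rfl _ _
    exact ConcreteCategory.congr_hom (B.map_comp α β) s.base

variable (p q u) in
/-- The projection of `pushforward p q u` to the base. -/
def pushforwardπ : pushforward p q u ⟶ B where
  app n := ↾fun s ↦ s.base

lemma pushforward_sec_congr {T : SSet.{0}} (f : T ⟶ pushforward p q u)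
    {n n' m : SimplexCategoryᵒᵖ} {y : T.obj n} {y' : T.obj n'} {θ : n ⟶ m} {θ' : n' ⟶ m}
    (hy : T.map θ y = T.map θ' y') {x x' : E.obj m} (hx : x = x')
    (h : p.app m x = B.map θ (PushforwardSimplex.base (f.app n y)))
    (h' : p.app m x' = B.map θ' (PushforwardSimplex.base (f.app n' y'))) :
    PushforwardSimplex.sec (f.app n y) θ x h = PushforwardSimplex.sec (f.app n' y') θ' x' h' := by
  subst hx
  have H : (pushforward p q u).map θ (f.app n y) = (pushforward p q u).map θ' (f.app n' y') := by
    rw [← NatTrans.naturality_apply, ← NatTrans.naturality_apply, hy]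
  have h₁ : p.app m x = B.map (𝟙 m) (B.map θ (PushforwardSimplex.base (f.app n y))) := by
    simpa using h
  have h₁' : p.app m x = B.map (𝟙 m) (B.map θ' (PushforwardSimplex.base (f.app n' y'))) := by
    simpa using h'
  have h₂ : PushforwardSimplex.sec ((pushforward p q u).map θ (f.app n y)) (𝟙 m) x h₁ =
      PushforwardSimplex.sec (f.app n y) θ x h :=
    PushforwardSimplex.sec_congr rfl (Category.comp_id θ) rfl _ _
  have h₂' : PushforwardSimplex.sec ((pushforward p q u).map θ' (f.app n' y')) (𝟙 m) x h₁' =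
      PushforwardSimplex.sec (f.app n' y') θ' x h' :=
    PushforwardSimplex.sec_congr rfl (Category.comp_id θ') rfl _ _
  rw [← h₂, ← h₂']
  exact PushforwardSimplex.sec_congr H rfl rfl _ _

/-- The map to `Z` from a simplicial set over `E` induced by a map to `pushforward p q u`. -/
def pushforwardEval {P T : SSet.{0}} (e : P ⟶ E) (r : P ⟶ T) (f : T ⟶ pushforward p q u)
    (w : e ≫ p = r ≫ f ≫ pushforwardπ p q u) : P ⟶ Z where
  app n := ↾fun x ↦ PushforwardSimplex.sec (f.app n (r.app n x)) (𝟙 n) (e.app n x)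
    (by simpa using! ConcreteCategory.congr_hom (congr_app w n) x)
  naturality n m α := by
    ext x
    have hx : p.app n (e.app n x) =
        B.map (𝟙 n) (PushforwardSimplex.base (f.app n (r.app n x))) := by
      simpa using! ConcreteCategory.congr_hom (congr_app w n) x
    refine Eq.trans ?_ (PushforwardSimplex.map_sec _ (𝟙 n) α _ hx ?_).symm
    · refine pushforward_sec_congr f ?_ (NatTrans.naturality_apply e α x) _ _
      exact (by simp : T.map (𝟙 m) (r.app m (P.map α x)) = T.map (𝟙 n ≫ α) (r.app n x))
    · simpa using! ConcreteCategory.congr_hom (congr_app w m) (P.map α x)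

lemma pushforwardEval_comp {P T : SSet.{0}} (e : P ⟶ E) (r : P ⟶ T)
    (f : T ⟶ pushforward p q u) (w : e ≫ p = r ≫ f ≫ pushforwardπ p q u) :
    pushforwardEval e r f w ≫ q = e ≫ u := by
  ext n x
  exact PushforwardSimplex.app_sec _ _ _ _

/-- The map to `pushforward p q u` determined by a map to `Z` from a fiber product. -/
lemma exists_pushforward_hom {P T : SSet.{0}} {e : P ⟶ E} {r : P ⟶ T} {t : T ⟶ B}
    (sq : IsPullback e r p t) (F : P ⟶ Z) (hF : F ≫ q = e ≫ u) :
    ∃ f : T ⟶ pushforward p q u, f ≫ pushforwardπ p q u = t ∧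
      ∀ (n : SimplexCategoryᵒᵖ) (y : T.obj n) (m : SimplexCategoryᵒᵖ) (θ : n ⟶ m) (w : P.obj m)
        (h), r.app m w = T.map θ y →
        PushforwardSimplex.sec (f.app n y) θ (e.app m w) h = F.app m w := by
  have hex : ∀ ⦃n m : SimplexCategoryᵒᵖ⦄ (y : T.obj n) (θ : n ⟶ m) (x : E.obj m)
      (_ : p.app m x = B.map θ (t.app n y)), ∃ w : P.obj m, e.app m w = x ∧
        r.app m w = T.map θ y := fun n m y θ x h ↦
    Types.exists_of_isPullback (sq.map ((evaluation _ _).obj m)) x (T.map θ y)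
      (h.trans (NatTrans.naturality_apply t θ y).symm)
  have hext : ∀ ⦃m : SimplexCategoryᵒᵖ⦄ (w w' : P.obj m), e.app m w = e.app m w' →
      r.app m w = r.app m w' → w = w' := fun m w w' h h' ↦
    Types.ext_of_isPullback (sq.map ((evaluation _ _).obj m)) h h'
  choose c hce hcr using hex
  let f : T ⟶ pushforward p q u :=
    { app n := ↾fun y ↦
        { base := t.app n y
          sec m θ x h := F.app m (c y θ x h)
          app_sec m θ x h :=
            (ConcreteCategory.congr_hom (congr_app hF m) _).trans
              (congrArg (u.app m) (hce y θ x h))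
          map_sec m m' θ η x h h' := by
            refine (NatTrans.naturality_apply F η _).symm.trans
              (congrArg (F.app m') (hext _ _ ?_ ?_))
            · exact (NatTrans.naturality_apply e η _).trans
                ((congrArg (E.map η) (hce y θ x h)).trans (hce y (θ ≫ η) _ h').symm)
            · exact (NatTrans.naturality_apply r η _).trans
                ((congrArg (T.map η) (hcr y θ x h)).trans
                  ((by simp : T.map η (T.map θ y) = T.map (θ ≫ η) y).trans
                    (hcr y (θ ≫ η) _ h').symm)) }
      naturality n n' α := by
        ext y
        refine PushforwardSimplex.ext' ?_ fun m θ x h h' ↦ congrArg (F.app m) (hext _ _ ?_ ?_)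
        · exact NatTrans.naturality_apply t α y
        · exact (hce _ _ _ _).trans (hce _ _ _ _).symm
        · refine (hcr _ _ _ _).trans (Eq.trans ?_ (hcr _ _ _ _).symm)
          exact (by simp : T.map θ (T.map α y) = T.map (α ≫ θ) y) }
  refine ⟨f, rfl, fun n y m θ w h h' ↦ ?_⟩
  change F.app _ _ = _
  congr 1
  apply hext
  · rw [hce]
  · rw [hcr, h']

lemma kanFibration_pushforwardπ (hp : KanFibration p) (hq : KanFibration q) :
    KanFibration (pushforwardπ p q u) := by
  intro n i
  constructor
  intro f b w
  let sq := IsPullback.of_hasPullback p b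
  let sq' := IsPullback.of_hasPullback (pullback.snd p b) Λ[n + 1, i].ι
  have := anodyne_of_isPullback_horn sq' (hp.of_isPullback sq) q hq
  have w₁ : (pullback.fst (pullback.snd p b) Λ[n + 1, i].ι ≫ pullback.fst p b) ≫ p =
      pullback.snd (pullback.snd p b) Λ[n + 1, i].ι ≫ f ≫ pushforwardπ p q u := by
    rw [w.w, Category.assoc, sq.w, reassoc_of% sq'.w]
  have sq₂ : CommSq (pushforwardEval _ _ f w₁) (pullback.fst (pullback.snd p b) Λ[n + 1, i].ι) q
      (pullback.fst p b ≫ u) := ⟨by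
    rw [pushforwardEval_comp, Category.assoc]⟩
  obtain ⟨g, hg, hg'⟩ := exists_pushforward_hom sq sq₂.lift sq₂.fac_right
  refine ⟨⟨⟨g, ?_, hg⟩⟩⟩
  ext n' y
  refine PushforwardSimplex.ext' ?_ fun m θ x h h' ↦ ?_
  · exact (ConcreteCategory.congr_hom (congr_app hg n') _).trans
      (ConcreteCategory.congr_hom (congr_app w.w n') y).symm
  · have hx : p.app m x = (Λ[n + 1, i].ι ≫ b).app m (Λ[n + 1, i].toSSet.map θ y) :=
      h'.trans ((congrArg (B.map θ) (ConcreteCategory.congr_hom (congr_app w.w n') y)).trans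
        (NatTrans.naturality_apply (Λ[n + 1, i].ι ≫ b) θ y).symm)
    obtain ⟨v, rfl, hv⟩ := Types.exists_of_isPullback
      ((sq'.paste_horiz sq).map ((evaluation _ _).obj m)) x
      (Λ[n + 1, i].toSSet.map θ y) hx
    refine (hg' n' _ m θ (sq'.cone.fst.app m v) h ?_).trans ?_
    · exact (ConcreteCategory.congr_hom (congr_app sq'.w m) v).trans
        (congrArg (Λ[n + 1, i].ι.app m) hv)
    · refine (ConcreteCategory.congr_hom (congr_app sq₂.fac_left m) v).trans ?_
      refine pushforward_sec_congr f ?_ rfl _ _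
      simpa using! hv

/-- Pullback along a Kan fibration preserves anodyne maps. -/
lemma Anodyne.of_isPullback {A P : SSet.{0}} {i : A ⟶ B} {i' : P ⟶ E} {p' : P ⟶ A}
    (sq : IsPullback i' p' p i) (hi : Anodyne i) (hp : KanFibration p) : Anodyne i' := by
  intro Z W q hq
  constructor
  intro z u w
  obtain ⟨f, hf, hf'⟩ := exists_pushforward_hom sq z w.w
  have := hi _ (kanFibration_pushforwardπ (u := u) hp hq)
  have sq₂ : CommSq f i (pushforwardπ p q u) (𝟙 B) := ⟨by simpa using hf⟩
  have wF : 𝟙 E ≫ p = p ≫ sq₂.lift ≫ pushforwardπ p q u := by simp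
  refine ⟨⟨⟨pushforwardEval (𝟙 E) p sq₂.lift wF, ?_, by simp [pushforwardEval_comp]⟩⟩⟩
  ext n x
  refine Eq.trans ?_ (hf' n (p'.app n x) n (𝟙 n) x ?_ (by simp))
  · have H : sq₂.lift.app n (i.app n (p'.app n x)) = f.app n (p'.app n x) :=
      ConcreteCategory.congr_hom (congr_app sq₂.fac_left n) _
    refine PushforwardSimplex.sec_congr (Eq.trans (congrArg (sq₂.lift.app n) ?_) H) rfl rfl _ _
    exact ConcreteCategory.congr_hom (congr_app sq.w n) x
  · refine (ConcreteCategory.congr_hom (congr_app sq.w n) x).trans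
      ((ConcreteCategory.congr_hom (congr_app hf n) (p'.app n x)).symm.trans ?_)
    exact (B.map_id_apply n _).symm

end DependentProduct

end Paper

/-- Frobenius property. Pullback along a Kan fibration preserves
anodyne maps. -/
theorem frobenius_property {X Y A B : SSet.{0}} (p : X ⟶ Y) (hp : Paper.KanFibration p)
    (i : A ⟶ B) (a : A ⟶ Y) (b : B ⟶ Y) (hi : Paper.Anodyne i) (hib : i ≫ b = a) :
    Paper.Anodyne (pullback.map p a p b (𝟙 X) i (𝟙 Y)
      (by rw [Category.comp_id, Category.id_comp])
      (by rw [Category.comp_id, hib])) := by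
  subst hib
  refine hi.of_isPullback (p := pullback.snd p b) (p' := pullback.snd p (i ≫ b)) ?_
    (hp.of_isPullback (IsPullback.of_hasPullback p b))
  refine IsPullback.of_right (h₁₁ := pullback.map p (i ≫ b) p b (𝟙 X) i (𝟙 Y) _ _)
    (t := IsPullback.of_hasPullback p b) ?_ ?_
  · convert IsPullback.of_hasPullback p (i ≫ b) using 1
    exact (pullback.lift_fst _ _ _).trans (Category.comp_id _)
  · exact pullback.lift_snd _ _ _
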